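/- Let Λ be an Artin algebra and I a finitely generated injective left Λ-module such that I-domdim Λ ≥ n+1 for some n ≥ 0. If Y is an (n+1)-st syzygy, i.e., there exists an exact sequence 0 → Y → P_n → P_{n−1} → ⋯ → P_0 of finitely generated Λ-modules with each P_i projective, then I-domdim Y ≥ n+1. -/

import Mathlib

open CategoryTheory

universe u

noncomputable instance hasExtModuleCat (A : Type u) [Ring A] : HasExt.{u+1} (ModuleCat.{u} A) :=
  letI := HasDerivedCategory.standard (ModuleCat.{u} A)
  hasExt_of_hasDerivedCategory _

/-- `Ext^i_A(X, Y) = 0`. -/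
def ExtVanishes (A : Type u) [Ring A] (X Y : Type u) [AddCommGroup X] [Module A X]
    [AddCommGroup Y] [Module A Y] (i : ℕ) : Prop :=
  Subsingleton (Abelian.Ext (ModuleCat.of A X) (ModuleCat.of A Y) i)

/-- `X ∈ add M`: `X` is a direct summand of a finite direct sum of copies of `M`. -/
def InAdd (Λ : Type u) [Ring Λ] (M : Type u) [AddCommGroup M] [Module Λ M]
    (X : Type u) [AddCommGroup X] [Module Λ X] : Prop :=
  ∃ (k : ℕ) (ι : X →ₗ[Λ] (Fin k → M)) (π : (Fin k → M) →ₗ[Λ] X), π ∘ₗ ι = LinearMap.id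

/-- `I`-domdim of `Y` is at least `t`: there is an exact sequence
`0 → Y → J_0 → ⋯ → J_{t-1}` with all `J_i ∈ add I`. -/
def IDomdimGE (Λ : Type u) [Ring Λ] (I : Type u) [AddCommGroup I] [Module Λ I]
    (Y : Type u) [AddCommGroup Y] [Module Λ Y] (t : ℕ) : Prop :=
  ∃ (J : ℕ → ModuleCat.{u} Λ) (g : Y →ₗ[Λ] J 0) (f : ∀ i, (J i : Type u) →ₗ[Λ] J (i+1)),
    (∀ i < t, InAdd Λ I (J i)) ∧
    (1 ≤ t → Function.Injective g) ∧
    (2 ≤ t → Function.Exact g (f 0)) ∧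
    (∀ i, i + 3 ≤ t → Function.Exact (f i) (f (i+1)))

/-- The projective dimension of `N` is at most `m`: there is a projective resolution
`0 → P_m → ⋯ → P_0 → N → 0`. -/
def ProjDimLE (Λ : Type u) [Ring Λ] (N : Type u) [AddCommGroup N] [Module Λ N] (m : ℕ) : Prop :=
  ∃ (P : ℕ → ModuleCat.{u} Λ) (f : ∀ i, (P (i+1) : Type u) →ₗ[Λ] P i) (g : (P 0 : Type u) →ₗ[Λ] N),
    (∀ i, Module.Projective Λ (P i)) ∧
    (∀ i, m < i → Subsingleton (P i)) ∧
    Function.Surjective g ∧ Function.Exact (f 0) g ∧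
    (∀ i, Function.Exact (f (i+1)) (f i))

/-- The injective dimension of `N` is at most `m`: there is an injective coresolution
`0 → N → J_0 → ⋯ → J_m → 0`. -/
def InjDimLE (Λ : Type u) [Ring Λ] (N : Type u) [AddCommGroup N] [Module Λ N] (m : ℕ) : Prop :=
  ∃ (J : ℕ → ModuleCat.{u} Λ) (g : N →ₗ[Λ] J 0) (f : ∀ i, (J i : Type u) →ₗ[Λ] J (i+1)),
    (∀ i, Module.Injective Λ (J i)) ∧
    (∀ i, m < i → Subsingleton (J i)) ∧
    Function.Injective g ∧ Function.Exact g (f 0) ∧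
    (∀ i, Function.Exact (f i) (f (i+1)))

/-- `M` is a cogenerator: every finitely generated module embeds into a finite
direct sum of copies of `M`. -/
def IsCogenerator (A : Type u) [Ring A] (M : Type u) [AddCommGroup M] [Module A M] : Prop :=
  ∀ (X : Type u) [AddCommGroup X] [Module A X], Module.Finite A X →
    ∃ (k : ℕ) (f : X →ₗ[A] (Fin k → M)), Function.Injective f

/-- `M`-codim `A ≤ m`: there is an exact sequence `0 → A → M_0 → ⋯ → M_m → 0` with all
`M_i ∈ add M` which stays exact after applying `Hom_A(-, M)`. -/
def MCodimLE (A : Type u) [Ring A] (M : Type u) [AddCommGroup M] [Module A M] (m : ℕ) : Prop :=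
  ∃ (C : ℕ → ModuleCat.{u} A) (g : A →ₗ[A] C 0) (f : ∀ i, (C i : Type u) →ₗ[A] C (i+1)),
    (∀ i ≤ m, InAdd A M (C i)) ∧
    (∀ i, m < i → Subsingleton (C i)) ∧
    Function.Injective g ∧ Function.Exact g (f 0) ∧
    (∀ i, Function.Exact (f i) (f (i+1))) ∧
    Function.Surjective (fun φ : (C 0 : Type u) →ₗ[A] M => φ ∘ₗ g) ∧
    Function.Exact (fun φ : (C 1 : Type u) →ₗ[A] M => φ ∘ₗ (f 0))
      (fun φ : (C 0 : Type u) →ₗ[A] M => φ ∘ₗ g) ∧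
    (∀ i, Function.Exact (fun φ : (C (i+2) : Type u) →ₗ[A] M => φ ∘ₗ (f (i+1)))
      (fun φ : (C (i+1) : Type u) →ₗ[A] M => φ ∘ₗ (f i)))

/-- The canonical ring homomorphism from `Λ` to the endomorphism ring of `I` over
`End_Λ(I)`, sending `λ` to multiplication by `λ`. -/
@[simps] def evalRingHom (Λ : Type u) [Ring Λ] (I : Type u) [AddCommGroup I] [Module Λ I] :
    Λ →+* Module.End (Module.End Λ I) I where
  toFun a :=
    { toFun := fun x => a • x
      map_add' := fun x y => smul_add a x y
      map_smul' := fun φ x => (φ.map_smul a x).symm }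
  map_one' := by ext x; simp
  map_mul' a b := by ext x; simp [mul_smul]
  map_zero' := by ext x; simp
  map_add' a b := by ext x; simp [add_smul]

namespace InAdd

variable {Λ : Type u} [Ring Λ] {I : Type u} [AddCommGroup I] [Module Λ I]
  {X : Type u} [AddCommGroup X] [Module Λ X] {X' : Type u} [AddCommGroup X'] [Module Λ X']

theorem prod (hX : InAdd Λ I X) (hX' : InAdd Λ I X') : InAdd Λ I (X × X') := by
  obtain ⟨k, ι, π, h⟩ := hX
  obtain ⟨l, ι', π', h'⟩ := hX'
  let e : (Fin (k + l) → I) ≃ₗ[Λ] (Fin k → I) × (Fin l → I) :=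
    (LinearEquiv.funCongrLeft Λ I finSumFinEquiv).trans
      (LinearEquiv.sumArrowLequivProdArrow (Fin k) (Fin l) Λ I)
  refine ⟨k + l, e.symm.toLinearMap ∘ₗ ι.prodMap ι', π.prodMap π' ∘ₗ e.toLinearMap, ?_⟩
  refine LinearMap.ext fun x => Prod.ext ?_ ?_
  · simpa using LinearMap.congr_fun h x.1
  · simpa using LinearMap.congr_fun h' x.2

theorem exists_extension (hI : Module.Injective Λ I) (hX : InAdd Λ I X)
    {A B : Type u} [AddCommGroup A] [Module Λ A] [AddCommGroup B] [Module Λ B]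
    (i : A →ₗ[Λ] B) (hi : Function.Injective i) (a : A →ₗ[Λ] X) :
    ∃ b : B →ₗ[Λ] X, ∀ x, b (i x) = a x := by
  obtain ⟨k, ι, π, h⟩ := hX
  choose b hb using fun j : Fin k => hI.out i hi (LinearMap.proj j ∘ₗ ι ∘ₗ a)
  refine ⟨π ∘ₗ LinearMap.pi b, fun x => ?_⟩
  have : LinearMap.pi b (i x) = ι (a x) := by
    ext j
    simpa using hb j x
  rw [LinearMap.comp_apply, this]
  exact LinearMap.congr_fun h (a x)

end InAdd

namespace IDomdimGE

variable {Λ : Type u} [Ring Λ] {I : Type u} [AddCommGroup I] [Module Λ I]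

section Basic

variable {Y : Type u} [AddCommGroup Y] [Module Λ Y] {Y' : Type u} [AddCommGroup Y'] [Module Λ Y']

theorem zero : IDomdimGE Λ I Y 0 :=
  ⟨fun _ => ModuleCat.of Λ PUnit, 0, fun _ => 0, by simp, by simp, by simp, by simp⟩

theorem mono {s t : ℕ} (hst : s ≤ t) (h : IDomdimGE Λ I Y t) : IDomdimGE Λ I Y s := by
  obtain ⟨J, g, f, h1, h2, h3, h4⟩ := h
  exact ⟨J, g, f, fun i hi => h1 i (by omega), fun _ => h2 (by omega), fun _ => h3 (by omega),
    fun i hi => h4 i (by omega)⟩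

theorem congr (e : Y ≃ₗ[Λ] Y') {t : ℕ} (h : IDomdimGE Λ I Y t) : IDomdimGE Λ I Y' t := by
  obtain ⟨J, g, f, h1, h2, h3, h4⟩ := h
  refine ⟨J, g ∘ₗ e.symm.toLinearMap, f, h1, fun ht => ?_, fun ht => ?_, h4⟩
  · simpa using h2 ht
  · rw [LinearMap.exact_iff, LinearMap.range_comp_of_range_eq_top _ e.symm.range]
    exact (LinearMap.exact_iff.mp (h3 ht))

theorem of_subsingleton [Subsingleton Y] (t : ℕ) : IDomdimGE Λ I Y t := by
  refine ⟨fun _ => ModuleCat.of Λ PUnit, 0, fun _ => 0, fun _ _ => ⟨0, 0, 0, Subsingleton.elim _ _⟩,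
    fun _ => Function.injective_of_subsingleton _, fun _ y => ?_, fun _ _ y => ?_⟩
  · exact ⟨fun _ => ⟨0, Subsingleton.elim _ _⟩, fun _ => Subsingleton.elim _ _⟩
  · exact ⟨fun _ => ⟨0, Subsingleton.elim _ _⟩, fun _ => Subsingleton.elim _ _⟩

theorem exists_cokernel {t : ℕ} (h : IDomdimGE Λ I Y (t + 1)) :
    ∃ (J : ModuleCat.{u} Λ) (g : Y →ₗ[Λ] J), InAdd Λ I J ∧ Function.Injective g ∧
      IDomdimGE Λ I ((J : Type u) ⧸ LinearMap.range g) t := by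
  obtain ⟨J, g, f, h1, h2, h3, h4⟩ := h
  refine ⟨J 0, g, h1 0 (by omega), h2 (by omega), ?_⟩
  rcases Nat.eq_zero_or_pos t with rfl | ht
  · exact zero
  have hk : LinearMap.ker (f 0) = LinearMap.range g := LinearMap.exact_iff.mp (h3 (by omega))
  refine ⟨fun i => J (i + 1), (LinearMap.range g).liftQ (f 0) hk.ge, fun i => f (i + 1),
    fun i hi => h1 _ (by omega), fun _ => ?_, fun _ => ?_, fun i hi => h4 _ (by omega)⟩
  · rw [← LinearMap.ker_eq_bot]
    exact Submodule.ker_liftQ_eq_bot _ _ _ hk.le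
  · rw [LinearMap.exact_iff, Submodule.range_liftQ]
    exact LinearMap.exact_iff.mp (h4 0 (by omega))

theorem of_cokernel {t : ℕ} {J : ModuleCat.{u} Λ} (hJ : InAdd Λ I J) (g : Y →ₗ[Λ] J)
    (hg : Function.Injective g) (h : IDomdimGE Λ I ((J : Type u) ⧸ LinearMap.range g) t) :
    IDomdimGE Λ I Y (t + 1) := by
  obtain ⟨K, g', f, h1, h2, h3, h4⟩ := h
  let J' : ℕ → ModuleCat.{u} Λ := fun i =>
    match i with
    | 0 => J
    | i + 1 => K i
  let f' : ∀ i : ℕ, (J' i : Type u) →ₗ[Λ] (J' (i + 1) : Type u) := fun i =>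
    match i with
    | 0 => g' ∘ₗ (LinearMap.range g).mkQ
    | i + 1 => f i
  refine ⟨J', g, f', fun i hi => ?_, fun _ => hg, fun ht => ?_, fun i hi => ?_⟩
  · cases i with
    | zero => exact hJ
    | succ i => exact h1 i (by omega)
  · change Function.Exact g (g' ∘ₗ (LinearMap.range g).mkQ)
    rw [LinearMap.exact_iff, LinearMap.ker_comp_of_ker_eq_bot _
      (LinearMap.ker_eq_bot.mpr (h2 (by omega))), Submodule.ker_mkQ]
  · cases i with
    | zero =>
      change Function.Exact (g' ∘ₗ (LinearMap.range g).mkQ) (f 0)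
      rw [LinearMap.exact_iff, LinearMap.range_comp_of_range_eq_top _ (Submodule.range_mkQ _)]
      exact LinearMap.exact_iff.mp (h3 (by omega))
    | succ i => exact h4 i (by omega)

end Basic

theorem of_extension (hI : Module.Injective Λ I) (t : ℕ) :
    ∀ {A B C : Type u} [AddCommGroup A] [Module Λ A] [AddCommGroup B] [Module Λ B]
      [AddCommGroup C] [Module Λ C] (i : A →ₗ[Λ] B) (q : B →ₗ[Λ] C),
      Function.Injective i → Function.Exact i q → Function.Surjective q →
      IDomdimGE Λ I A t → IDomdimGE Λ I C t → IDomdimGE Λ I B t := by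
  induction t with
  | zero => intros; exact zero
  | succ t ih =>
    intro A B C _ _ _ _ _ _ i q hi hiq hq hA hC
    obtain ⟨J, a, hJ, ha, hA'⟩ := hA.exists_cokernel
    obtain ⟨K, c, hK, hc, hC'⟩ := hC.exists_cokernel
    obtain ⟨b, hb⟩ := hJ.exists_extension hI i hi a
    let β : B →ₗ[Λ] (J × K) := b.prod (c ∘ₗ q)
    have hqi : ∀ x, q (i x) = 0 := hiq.apply_apply_eq_zero
    have hker : ∀ y, c (q y) = 0 → ∃ x, i x = y := fun y hy =>
      (hiq y).mp (hc (hy.trans (map_zero c).symm))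
    have hβ : Function.Injective β := by
      rw [injective_iff_map_eq_zero]
      intro y hy
      obtain ⟨h1, h2⟩ := Prod.ext_iff.mp hy
      obtain ⟨x, rfl⟩ := hker y h2
      have : a x = a 0 := by rw [← hb, map_zero]; exact h1
      rw [ha this, map_zero]
    refine of_cokernel (J := ModuleCat.of Λ (J × K)) (hJ.prod hK) β hβ ?_
    have hl : LinearMap.range a ≤ (LinearMap.range β).comap (LinearMap.inl Λ J K) := by
      rintro _ ⟨x, rfl⟩
      exact ⟨i x, by simp [β, hb, hqi]⟩
    have hs : LinearMap.range β ≤ (LinearMap.range c).comap (LinearMap.snd Λ J K) := by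
      rintro _ ⟨y, rfl⟩
      exact ⟨q y, rfl⟩
    refine ih (Submodule.mapQ _ _ _ hl) (Submodule.mapQ _ _ _ hs) ?_ ?_ ?_ hA' hC'
    · rw [injective_iff_map_eq_zero]
      intro z hz
      obtain ⟨x, rfl⟩ := Submodule.Quotient.mk_surjective _ z
      rw [Submodule.mapQ_apply, Submodule.Quotient.mk_eq_zero] at hz
      obtain ⟨y, hy⟩ := hz
      obtain ⟨h1, h2⟩ := Prod.ext_iff.mp hy
      obtain ⟨w, rfl⟩ := hker y h2
      exact (Submodule.Quotient.mk_eq_zero _).mpr ⟨w, (hb w).symm.trans h1⟩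
    · intro z
      constructor
      · obtain ⟨⟨x, k⟩, rfl⟩ := Submodule.Quotient.mk_surjective _ z
        rw [Submodule.mapQ_apply, Submodule.Quotient.mk_eq_zero]
        rintro ⟨w, hw⟩
        obtain ⟨y, rfl⟩ := hq w
        refine ⟨Submodule.Quotient.mk (x - b y), ?_⟩
        rw [Submodule.mapQ_apply, Submodule.Quotient.eq]
        refine ⟨-y, Prod.ext ?_ ?_⟩
        · simp [β]
        · simpa [β] using hw
      · rintro ⟨w, rfl⟩
        obtain ⟨x, rfl⟩ := Submodule.Quotient.mk_surjective _ w
        simp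
    · intro z
      obtain ⟨k, rfl⟩ := Submodule.Quotient.mk_surjective _ z
      exact ⟨Submodule.Quotient.mk (0, k), rfl⟩

theorem of_kernel (hI : Module.Injective Λ I) {t : ℕ}
    {Y P Z : Type u} [AddCommGroup Y] [Module Λ Y] [AddCommGroup P] [Module Λ P]
    [AddCommGroup Z] [Module Λ Z] (i : Y →ₗ[Λ] P) (h : P →ₗ[Λ] Z)
    (hi : Function.Injective i) (hih : Function.Exact i h) (hh : Function.Surjective h)
    (hP : IDomdimGE Λ I P (t + 1)) (hZ : IDomdimGE Λ I Z t) : IDomdimGE Λ I Y (t + 1) := by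
  obtain ⟨J, g, hJ, hg, hJ'⟩ := hP.exists_cokernel
  refine of_cokernel hJ (g ∘ₗ i) (hg.comp hi) ?_
  have hk : LinearMap.ker h = LinearMap.range i := LinearMap.exact_iff.mp hih
  have hZ' : IDomdimGE Λ I (P ⧸ LinearMap.range i) t :=
    hZ.congr ((Submodule.quotEquivOfEq _ _ hk.symm).trans (h.quotKerEquivOfSurjective hh)).symm
  have h1 : LinearMap.range i ≤ (LinearMap.range (g ∘ₗ i)).comap g := by
    rintro _ ⟨x, rfl⟩
    exact ⟨x, rfl⟩
  have h2 : LinearMap.range (g ∘ₗ i) ≤ (LinearMap.range g).comap LinearMap.id :=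
    LinearMap.range_comp_le_range _ _
  refine of_extension hI t (Submodule.mapQ _ _ g h1) (Submodule.mapQ _ _ _ h2) ?_ ?_ ?_ hZ' hJ'
  · rw [injective_iff_map_eq_zero]
    intro z hz
    obtain ⟨x, rfl⟩ := Submodule.Quotient.mk_surjective _ z
    rw [Submodule.mapQ_apply, Submodule.Quotient.mk_eq_zero] at hz
    obtain ⟨y, hy⟩ := hz
    exact (Submodule.Quotient.mk_eq_zero _).mpr ⟨y, hg hy⟩
  · intro z
    constructor
    · obtain ⟨x, rfl⟩ := Submodule.Quotient.mk_surjective _ z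
      rw [Submodule.mapQ_apply, Submodule.Quotient.mk_eq_zero]
      rintro ⟨w, hw⟩
      exact ⟨Submodule.Quotient.mk w, congrArg Submodule.Quotient.mk hw⟩
    · rintro ⟨w, rfl⟩
      obtain ⟨x, rfl⟩ := Submodule.Quotient.mk_surjective _ w
      simp
  · intro z
    obtain ⟨k, rfl⟩ := Submodule.Quotient.mk_surjective _ z
    exact ⟨Submodule.Quotient.mk k, rfl⟩

theorem pi_fin (hI : Module.Injective Λ I) {t : ℕ} {X : Type u} [AddCommGroup X] [Module Λ X]
    (hX : IDomdimGE Λ I X t) (k : ℕ) : IDomdimGE Λ I (Fin k → X) t := by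
  induction k with
  | zero => exact of_subsingleton t
  | succ k ih =>
    refine (of_extension hI t (LinearMap.inl Λ X (Fin k → X)) (LinearMap.snd Λ X (Fin k → X))
      LinearMap.inl_injective .inl_snd LinearMap.snd_surjective hX ih).congr
      (Fin.consLinearEquiv Λ fun _ => X)

/-- Modules of `I`-dominant dimension at least `t` are closed under `add`. -/
theorem of_inAdd (hI : Module.Injective Λ I) {X : Type u} [AddCommGroup X] [Module Λ X] (t : ℕ) :
    ∀ {P : Type u} [AddCommGroup P] [Module Λ P], IDomdimGE Λ I X t → InAdd Λ X P →
      IDomdimGE Λ I P t := by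
  induction t with
  | zero => intros; exact zero
  | succ t ih =>
    intro P _ _ hX hP
    obtain ⟨k, s, h, hhs⟩ := hP
    have hs : ∀ x, h (s x) = x := LinearMap.congr_fun hhs
    let e : (Fin k → X) →ₗ[Λ] (Fin k → X) := LinearMap.id - s ∘ₗ h
    refine of_kernel hI s e.rangeRestrict (Function.LeftInverse.injective hs) (fun y => ?_)
      e.surjective_rangeRestrict (hX.pi_fin hI k)
      (ih (hX.mono t.le_succ) ⟨k, (LinearMap.range e).subtype, e.rangeRestrict, ?_⟩)
    · rw [← Subtype.coe_inj]
      constructor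
      · intro hy
        exact ⟨h y, (sub_eq_zero.mp hy).symm⟩
      · rintro ⟨x, rfl⟩
        simp [e, hs]
    · ext ⟨_, y, rfl⟩ : 2
      simp [e, hs]

theorem of_syzygy (hI : Module.Injective Λ I) (n : ℕ) :
    ∀ {Y : Type u} [AddCommGroup Y] [Module Λ Y] (Q : ℕ → ModuleCat.{u} Λ) (g : Y →ₗ[Λ] Q 0)
      (f : ∀ i, (Q i : Type u) →ₗ[Λ] Q (i + 1)),
      (∀ i ≤ n, IDomdimGE Λ I (Q i) (n + 1)) → Function.Injective g →
      (1 ≤ n → Function.Exact g (f 0)) →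
      (∀ i, i + 2 ≤ n → Function.Exact (f i) (f (i + 1))) → IDomdimGE Λ I Y (n + 1) := by
  induction n with
  | zero =>
    intro Y _ _ Q g f hQ hg _ _
    exact of_kernel hI g (LinearMap.range g).mkQ hg (LinearMap.exact_map_mkQ_range g)
      (Submodule.mkQ_surjective _) (hQ 0 le_rfl) zero
  | succ n ih =>
    intro Y _ _ Q g f hQ hg hgf hf
    refine of_kernel hI g (f 0).rangeRestrict hg ?_ (f 0).surjective_rangeRestrict
      (hQ 0 (Nat.zero_le _)) (ih (fun i => Q (i + 1)) (LinearMap.range (f 0)).subtype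
        (fun i => f (i + 1)) (fun i hi => (hQ _ (by omega)).mono (by omega))
        (Submodule.subtype_injective _) (fun hn => ?_) (fun i hi => hf _ (by omega)))
    · rw [LinearMap.exact_iff, LinearMap.ker_rangeRestrict]
      exact LinearMap.exact_iff.mp (hgf (by omega))
    · rw [LinearMap.exact_iff, Submodule.range_subtype]
      exact LinearMap.exact_iff.mp (hf 0 (by omega))

end IDomdimGE

theorem Module.Projective.inAdd {Λ : Type u} [Ring Λ] (P : Type u) [AddCommGroup P] [Module Λ P]
    [Module.Projective Λ P] [Module.Finite Λ P] : InAdd Λ Λ P := by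
  obtain ⟨k, h, hh⟩ := Module.Finite.exists_fin' Λ P
  obtain ⟨s, hs⟩ := Module.projective_lifting_property h LinearMap.id hh
  exact ⟨k, s, h, hs⟩

/-- Let `Λ` be an Artin algebra and `I` a finitely generated injective
`Λ`-module with `I`-domdim `Λ ≥ n+1`. If `Y` is an `(n+1)`-st syzygy, i.e. there is an exact
sequence `0 → Y → P_n → ⋯ → P_0` with all `P_i` finitely generated projective, then
`I`-domdim `Y ≥ n+1`. -/
theorem stmt11 (R : Type u) [CommRing R] [IsArtinianRing R]
    (Λ : Type u) [Ring Λ] [Algebra R Λ] [Module.Finite R Λ]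
    (I : Type u) [AddCommGroup I] [Module Λ I] [Module.Finite Λ I]
    (hIinj : Module.Injective Λ I)
    (n : ℕ)
    (hdom : IDomdimGE Λ I Λ (n + 1))
    (Y : Type u) [AddCommGroup Y] [Module Λ Y] [Module.Finite Λ Y]
    (hsyz : ∃ (Q : ℕ → ModuleCat.{u} Λ) (g : Y →ₗ[Λ] Q 0)
        (f : ∀ i, (Q i : Type u) →ₗ[Λ] Q (i+1)),
      (∀ i ≤ n, Module.Projective Λ (Q i) ∧ Module.Finite Λ (Q i)) ∧
      Function.Injective g ∧ (1 ≤ n → Function.Exact g (f 0)) ∧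
      (∀ i, i + 2 ≤ n → Function.Exact (f i) (f (i+1)))) :
    IDomdimGE Λ I Y (n + 1) := by
  obtain ⟨Q, g, f, hQ, hg, hgf, hf⟩ := hsyz
  refine IDomdimGE.of_syzygy hIinj n Q g f (fun i hi => ?_) hg hgf hf
  obtain ⟨_, _⟩ := hQ i hi
  exact IDomdimGE.of_inAdd hIinj (n + 1) hdom (Module.Projective.inAdd (Q i))
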